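/- Let κ be a perfect kernel on X, f an external field, and A ⊆ X with w_f(A) < ∞. Suppose the solution λ_{A,f} of the inner Gauss variational problem for (A, f) exists. Then there is a compact set K₀ ⊆ A such that for every compact K with K₀ ⊆ K ⊆ A the solution λ_{K,f} of the problem for (K, f) exists, and λ_{K,f} → λ_{A,f} both in the strong metric d and vaguely as K ↑ A. -/

import Mathlib

open MeasureTheory Topology Filter Set ENNReal

noncomputable section

namespace GaussVar

variable {X : Type*} [TopologicalSpace X] [MeasurableSpace X]

/-- A (positive) Radon measure: a regular Borel measure. -/
def IsRadon (μ : Measure X) : Prop := μ.Regular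

/-- The mutual energy `I(μ,ν) = ∬ κ(x,y) d(μ⊗ν)(x,y)`. -/
def mutualEnergy (κ : X → X → ℝ≥0∞) (μ ν : Measure X) : ℝ≥0∞ :=
  ∫⁻ p : X × X, κ p.1 p.2 ∂(μ.prod ν)

/-- The energy `I(μ) := I(μ,μ)`. -/
def energy (κ : X → X → ℝ≥0∞) (μ : Measure X) : ℝ≥0∞ := mutualEnergy κ μ μ

/-- Membership in the cone `E⁺` of Radon measures with finite energy. -/
def memEplus (κ : X → X → ℝ≥0∞) (μ : Measure X) : Prop :=
  IsRadon μ ∧ energy κ μ < ⊤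

/-- A kernel: symmetric and lower semicontinuous with values in `[0,∞]`. -/
def IsKernel (κ : X → X → ℝ≥0∞) : Prop :=
  (∀ x y, κ x y = κ y x) ∧ LowerSemicontinuous (fun p : X × X => κ p.1 p.2)

/-- The strong (energy) metric `d(μ,ν) := (I(μ)+I(ν)−2I(μ,ν))^{1/2}` on `E⁺`. -/
def strongDist (κ : X → X → ℝ≥0∞) (μ ν : Measure X) : ℝ :=
  Real.sqrt ((energy κ μ).toReal + (energy κ ν).toReal - 2 * (mutualEnergy κ μ ν).toReal)

/-- The energy principle (strict positive definiteness). -/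
def EnergyPrinciple (κ : X → X → ℝ≥0∞) : Prop :=
  ∀ μ ν : Measure X, memEplus κ μ → memEplus κ ν →
    2 * mutualEnergy κ μ ν ≤ energy κ μ + energy κ ν ∧
      (2 * mutualEnergy κ μ ν = energy κ μ + energy κ ν → μ = ν)

/-- Convergence of a sequence in the strong metric. -/
def StrongTendstoSeq (κ : X → X → ℝ≥0∞) (μ : ℕ → Measure X) (μ₀ : Measure X) : Prop :=
  Tendsto (fun n => strongDist κ (μ n) μ₀) atTop (𝓝 0)

/-- Vague convergence of a sequence of measures. -/
def VagueTendstoSeq (μ : ℕ → Measure X) (μ₀ : Measure X) : Prop :=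
  ∀ φ : X → ℝ, Continuous φ → HasCompactSupport φ →
    Tendsto (fun n => ∫ x, φ x ∂(μ n)) atTop (𝓝 (∫ x, φ x ∂μ₀))

/-- Cauchy sequence in the strong metric. -/
def StrongCauchySeq (κ : X → X → ℝ≥0∞) (μ : ℕ → Measure X) : Prop :=
  ∀ ε : ℝ, 0 < ε → ∃ N : ℕ, ∀ m ≥ N, ∀ n ≥ N, strongDist κ (μ m) (μ n) < ε

/-- A perfect kernel: satisfies the energy principle, `(E⁺,d)` is complete, and
strong convergence implies vague convergence. -/
def IsPerfect (κ : X → X → ℝ≥0∞) : Prop :=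
  EnergyPrinciple κ ∧
    (∀ μ : ℕ → Measure X, (∀ n, memEplus κ (μ n)) → StrongCauchySeq κ μ →
        ∃ μ₀ : Measure X, memEplus κ μ₀ ∧ StrongTendstoSeq κ μ μ₀) ∧
    (∀ (μ : ℕ → Measure X) (μ₀ : Measure X), (∀ n, memEplus κ (μ n)) → memEplus κ μ₀ →
        StrongTendstoSeq κ μ μ₀ → VagueTendstoSeq μ μ₀)

/-- `μ` is concentrated on `A`: the complement of `A` is locally `μ`-negligible. -/
def Concentrated (μ : Measure X) (A : Set X) : Prop :=
  ∀ K : Set X, IsCompact K → μ (Aᶜ ∩ K) = 0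

/-- Membership in `Ĕ⁺(A)`: finite-energy Radon measures concentrated on `A`
of unit total mass. -/
def memBreve (κ : X → X → ℝ≥0∞) (A : Set X) (μ : Measure X) : Prop :=
  memEplus κ μ ∧ Concentrated μ A ∧ μ Set.univ = 1

/-- `w(A) := inf { I(μ) : μ ∈ Ĕ⁺(A) }` (with `inf ∅ = ⊤`). -/
def wcap (κ : X → X → ℝ≥0∞) (A : Set X) : ℝ≥0∞ :=
  ⨅ (μ : Measure X) (_ : memBreve κ A μ), energy κ μ

/-- The inner capacity `cap_*(A) := 1 / w(A)`. -/
def innerCap (κ : X → X → ℝ≥0∞) (A : Set X) : ℝ≥0∞ := (wcap κ A)⁻¹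

/-- The outer capacity `cap^*(E) := inf { cap_*(D) : D open, E ⊆ D }`. -/
def outerCap (κ : X → X → ℝ≥0∞) (E : Set X) : ℝ≥0∞ :=
  ⨅ (D : Set X) (_ : IsOpen D ∧ E ⊆ D), innerCap κ D

/-- `P` holds nearly everywhere (n.e.) on `A`: the exceptional subset of `A`
has inner capacity zero. -/
def NearlyEverywhere (κ : X → X → ℝ≥0∞) (A : Set X) (P : X → Prop) : Prop :=
  innerCap κ {x ∈ A | ¬ P x} = 0

/-- The potential `U^μ(x) := ∫ κ(x,y) dμ(y)`. -/
def potential (κ : X → X → ℝ≥0∞) (μ : Measure X) (x : X) : ℝ≥0∞ :=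
  ∫⁻ y, κ x y ∂μ

/-- An external field: `f = ψ + U^{ϑ⁺} − U^{ϑ⁻}` where `ψ` is lower semicontinuous,
`(−∞,∞]`-valued, positive if `X` is noncompact, and `ϑ⁺, ϑ⁻ ∈ E⁺`. -/
def IsExternalField (κ : X → X → ℝ≥0∞) (f : X → EReal) : Prop :=
  ∃ (ψ : X → EReal) (ϑp ϑm : Measure X),
    LowerSemicontinuous ψ ∧ (∀ x, ψ x ≠ ⊥) ∧ (¬ CompactSpace X → ∀ x, 0 ≤ ψ x) ∧
    memEplus κ ϑp ∧ memEplus κ ϑm ∧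
    ∀ x, f x = ψ x + (potential κ ϑp x : EReal) - (potential κ ϑm x : EReal)

/-- `f` is `μ`-integrable (as an extended-real-valued function). -/
def FieldIntegrable (f : X → EReal) (μ : Measure X) : Prop :=
  Integrable (fun x => (f x).toReal) μ ∧ (∀ᵐ x ∂μ, f x ≠ ⊤ ∧ f x ≠ ⊥)

/-- `∫ f dμ` for an a.e.-finite integrable field. -/
def fieldIntegral (f : X → EReal) (μ : Measure X) : ℝ := ∫ x, (f x).toReal ∂μ

/-- The Gauss functional `I_f(μ) := I(μ) + 2 ∫ f dμ`. -/
def gaussI (κ : X → X → ℝ≥0∞) (f : X → EReal) (μ : Measure X) : ℝ :=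
  (energy κ μ).toReal + 2 * fieldIntegral f μ

/-- Membership in `Ĕ⁺_f(A)`. -/
def Admissible (κ : X → X → ℝ≥0∞) (A : Set X) (f : X → EReal) (μ : Measure X) : Prop :=
  memBreve κ A μ ∧ FieldIntegrable f μ

/-- `w_f(A) := inf { I_f(μ) : μ ∈ Ĕ⁺_f(A) }` (with `inf ∅ = ⊤`). -/
def wf (κ : X → X → ℝ≥0∞) (A : Set X) (f : X → EReal) : EReal :=
  ⨅ (μ : Measure X) (_ : Admissible κ A f μ), ((gaussI κ f μ : ℝ) : EReal)

/-- `l` is a solution of the inner Gauss variational problem for `(A,f)`. -/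
def IsSolution (κ : X → X → ℝ≥0∞) (A : Set X) (f : X → EReal) (l : Measure X) : Prop :=
  Admissible κ A f l ∧ ((gaussI κ f l : ℝ) : EReal) = wf κ A f

/-- The `f`-weighted potential `U_f^μ := U^μ + f`. -/
def wPotential (κ : X → X → ℝ≥0∞) (f : X → EReal) (μ : Measure X) (x : X) : EReal :=
  (potential κ μ x : EReal) + f x

/-- `∫ U_f^μ dμ`, the weighted equilibrium constant of a solution. -/
def wConst (κ : X → X → ℝ≥0∞) (f : X → EReal) (μ : Measure X) : ℝ :=
  ∫ x, (wPotential κ f μ x).toReal ∂μ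

/-- The cone `E⁺(A)` is closed in the strong metric. -/
def StrongClosedEplusOn (κ : X → X → ℝ≥0∞) (A : Set X) : Prop :=
  ∀ (μ : ℕ → Measure X) (μ₀ : Measure X),
    (∀ n, memEplus κ (μ n) ∧ Concentrated (μ n) A) →
    memEplus κ μ₀ → StrongTendstoSeq κ μ μ₀ → Concentrated μ₀ A

/-- Frostman's (first) maximum principle. -/
def FrostmanMax (κ : X → X → ℝ≥0∞) : Prop :=
  ∀ μ : Measure X, memEplus κ μ →
    (∀ x : X, (∀ U : Set X, IsOpen U → x ∈ U → 0 < μ U) → potential κ μ x ≤ 1) →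
    ∀ x : X, potential κ μ x ≤ 1

/-- The domination (second maximum) principle. -/
def DominationPrinciple (κ : X → X → ℝ≥0∞) : Prop :=
  ∀ μ ν : Measure X, memEplus κ μ → memEplus κ ν →
    (∀ᵐ x ∂μ, potential κ μ x ≤ potential κ ν x) →
    ∀ x : X, potential κ μ x ≤ potential κ ν x

/-- `β` is the inner balayage of `ζ` onto `A`: `β ∈ E⁺(A)` and `U^β = U^ζ` n.e. on `A`. -/
def IsInnerBalayage (κ : X → X → ℝ≥0∞) (A : Set X) (ζ β : Measure X) : Prop :=
  memEplus κ β ∧ Concentrated β A ∧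
    NearlyEverywhere κ A (fun x => potential κ β x = potential κ ζ x)

/-- `γ` is the inner capacitary measure of `A`: `γ ∈ E⁺(A)` and `U^γ = 1` n.e. on `A`. -/
def IsCapacitaryMeasure (κ : X → X → ℝ≥0∞) (A : Set X) (γ : Measure X) : Prop :=
  memEplus κ γ ∧ Concentrated γ A ∧
    NearlyEverywhere κ A (fun x => potential κ γ x = 1)

/-- `A` is quasiclosed: approximable in outer capacity by closed sets. -/
def Quasiclosed (κ : X → X → ℝ≥0∞) (A : Set X) : Prop :=
  ∀ ε : ℝ≥0∞, 0 < ε → ∃ F : Set X, IsClosed F ∧ outerCap κ (symmDiff A F) < ε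

/-- `A` is quasicompact: approximable in outer capacity by compact sets. -/
def Quasicompact (κ : X → X → ℝ≥0∞) (A : Set X) : Prop :=
  ∀ ε : ℝ≥0∞, 0 < ε → ∃ K : Set X, IsCompact K ∧ outerCap κ (symmDiff A K) < ε

/-- Riemann sum approximation of `y` from below with mesh `δ`. -/
def stepSum (δ y : ℝ≥0∞) : ℝ≥0∞ := ∑' k : ℕ, if (k + 1) * δ < y then δ else 0

lemma stepSum_le (δ y : ℝ≥0∞) : stepSum δ y ≤ y := by
  unfold stepSum
  rw [ENNReal.tsum_eq_iSup_nat]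
  refine iSup_le fun N => ?_
  induction N with
  | zero => simp
  | succ N ih =>
    by_cases h : ((N : ℝ≥0∞) + 1) * δ < y
    · calc ∑ k ∈ Finset.range (N + 1), (if ((k : ℝ≥0∞) + 1) * δ < y then δ else 0)
          ≤ ∑ k ∈ Finset.range (N + 1), δ := by
            refine Finset.sum_le_sum fun k _ => ?_
            split_ifs <;> simp
        _ = ((N : ℝ≥0∞) + 1) * δ := by simp
        _ ≤ y := h.le
    · rw [Finset.sum_range_succ, if_neg h, add_zero]
      exact ih

lemma le_stepSum_of_lt {δ y : ℝ≥0∞} {m : ℕ} (h : m * δ < y) : m * δ ≤ stepSum δ y := by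
  calc (m : ℝ≥0∞) * δ = ∑ k ∈ Finset.range m, δ := by simp
    _ = ∑ k ∈ Finset.range m, (if ((k : ℝ≥0∞) + 1) * δ < y then δ else 0) := by
      refine Finset.sum_congr rfl fun k hk => ?_
      rw [if_pos]
      refine lt_of_le_of_lt ?_ h
      have : k + 1 ≤ m := Finset.mem_range.1 hk
      gcongr
      exact_mod_cast this
    _ ≤ stepSum δ y := ENNReal.sum_le_tsum _

lemma le_liminf_stepSum (y : ℝ≥0∞) :
    y ≤ liminf (fun n : ℕ => stepSum (ENNReal.ofReal (1 / (n + 1))) y) atTop := by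
  refine le_of_forall_lt fun t ht => ?_
  obtain ⟨t', htt', ht'y⟩ := exists_between ht
  obtain ⟨t'', ht1, ht2⟩ := exists_between ht'y
  refine lt_of_lt_of_le htt' (le_liminf_of_le (by isBoundedDefault) ?_)
  have ht'top : t' ≠ ⊤ := ne_top_of_lt ht'y
  have ht''top : t'' ≠ ⊤ := ne_top_of_lt ht2
  have hpos : 0 < t''.toReal - t'.toReal :=
    sub_pos.2 ((ENNReal.toReal_lt_toReal ht'top ht''top).2 ht1)
  have hev := (tendsto_one_div_add_atTop_nhds_zero_nat (𝕜 := ℝ)).eventually_lt_const hpos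
  filter_upwards [hev] with n hn
  have hn0 : (0 : ℝ) < n + 1 := by positivity
  set m := ⌈t'.toReal * (n + 1)⌉₊
  have hm1 : t'.toReal * (n + 1) ≤ m := Nat.le_ceil _
  have hm2 : (m : ℝ) < t'.toReal * (n + 1) + 1 := Nat.ceil_lt_add_one (by positivity)
  have hmul : (m : ℝ≥0∞) * ENNReal.ofReal (1 / (n + 1)) = ENNReal.ofReal (m * (1 / (n + 1))) := by
    rw [ENNReal.ofReal_mul (by positivity), ENNReal.ofReal_natCast]
  have h1 : t' ≤ m * ENNReal.ofReal (1 / (n + 1)) := by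
    rw [hmul, ENNReal.le_ofReal_iff_toReal_le ht'top (by positivity), mul_one_div,
      le_div_iff₀ hn0]
    exact hm1
  have h2 : m * ENNReal.ofReal (1 / (n + 1)) < y := by
    refine lt_of_le_of_lt ?_ ht2
    rw [hmul]
    refine ENNReal.ofReal_le_of_le_toReal ?_
    have : (m : ℝ) * (1 / (n + 1)) < t'.toReal + 1 / (n + 1) := by
      rw [mul_one_div, div_lt_iff₀ hn0, add_mul, one_div, inv_mul_cancel₀ hn0.ne']
      exact hm2
    linarith
  exact h1.trans (le_stepSum_of_lt h2)

section Topological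

variable [BorelSpace X]

omit [TopologicalSpace X] [BorelSpace X] in
lemma lintegral_stepSum (μ : Measure X) {g : X → ℝ≥0∞} (hg : Measurable g) (δ : ℝ≥0∞) :
    ∫⁻ x, stepSum δ (g x) ∂μ = ∑' k : ℕ, δ * μ {x | (k + 1) * δ < g x} := by
  unfold stepSum
  have hm : ∀ k : ℕ, MeasurableSet {x | ((k : ℝ≥0∞) + 1) * δ < g x} := fun k =>
    measurableSet_lt measurable_const hg
  rw [lintegral_tsum fun k => (Measurable.ite (hm k) measurable_const measurable_const).aemeasurable]
  congr 1 with k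
  rw [← lintegral_indicator_const (hm k)]
  exact lintegral_congr fun x => by simp [indicator_apply]

lemma measurable_stepSum (δ : ℝ≥0∞) : Measurable (stepSum δ) := by
  unfold stepSum
  exact Measurable.tsum fun k =>
    Measurable.ite (measurableSet_lt measurable_const measurable_id)
      measurable_const measurable_const

omit [BorelSpace X] in
lemma measure_lt_iSup_of_directed {ι : Type*} (μ : Measure X) [μ.Regular] {g : ι → X → ℝ≥0∞}
    (hg : ∀ i, LowerSemicontinuous (g i)) (hdir : Directed (· ≤ ·) g) (t : ℝ≥0∞) :
    μ {x | t < ⨆ i, g i x} = ⨆ i, μ {x | t < g i x} := by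
  refine le_antisymm ?_ (iSup_le fun i => measure_mono fun x hx =>
    lt_of_lt_of_le hx (le_iSup (fun i => g i x) i))
  have hopen : IsOpen {x | t < ⨆ i, g i x} := (lowerSemicontinuous_iSup hg).isOpen_preimage t
  rw [hopen.measure_eq_iSup_isCompact]
  refine iSup_le fun C => iSup_le fun hC => iSup_le fun hCc => ?_
  rcases isEmpty_or_nonempty ι with hι | hι
  · have : C = ∅ := by
      refine eq_empty_of_forall_notMem fun x hx => ?_
      have := hC hx
      simp at this
    simp [this]
  obtain ⟨i, hi⟩ := hCc.elim_directed_cover (fun i => {x | t < g i x})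
    (fun i => (hg i).isOpen_preimage t)
    (fun x hx => by simpa [lt_iSup_iff] using hC hx)
    (fun i j => by
      obtain ⟨k, hik, hjk⟩ := hdir i j
      exact ⟨k, fun x hx => lt_of_lt_of_le hx (hik x), fun x hx => lt_of_lt_of_le hx (hjk x)⟩)
  exact (measure_mono hi).trans (le_iSup (fun i => μ {x | t < g i x}) i)

/-- Monotone convergence for directed families of lower semicontinuous functions. -/
theorem lintegral_iSup_of_lowerSemicontinuous {ι : Type*} (μ : Measure X) [μ.Regular]
    {g : ι → X → ℝ≥0∞} (hg : ∀ i, LowerSemicontinuous (g i)) (hdir : Directed (· ≤ ·) g) :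
    ∫⁻ x, ⨆ i, g i x ∂μ = ⨆ i, ∫⁻ x, g i x ∂μ := by
  refine le_antisymm ?_ (iSup_le fun i => lintegral_mono fun x => le_iSup (fun i => g i x) i)
  have hsup : Measurable fun x => ⨆ i, g i x := (lowerSemicontinuous_iSup hg).measurable
  calc ∫⁻ x, ⨆ i, g i x ∂μ
      ≤ ∫⁻ x, liminf (fun n : ℕ => stepSum (ENNReal.ofReal (1 / (n + 1))) (⨆ i, g i x)) atTop ∂μ :=
        lintegral_mono fun x => le_liminf_stepSum _
    _ ≤ liminf (fun n : ℕ =>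
          ∫⁻ x, stepSum (ENNReal.ofReal (1 / (n + 1))) (⨆ i, g i x) ∂μ) atTop :=
        lintegral_liminf_le fun n => (measurable_stepSum _).comp hsup
    _ ≤ ⨆ i, ∫⁻ x, g i x ∂μ := by
        refine liminf_le_of_le (by isBoundedDefault) fun b hb => ?_
        obtain ⟨n, hn⟩ := hb.exists
        refine hn.trans ?_
        set δ := ENNReal.ofReal (1 / ((n : ℝ) + 1))
        rw [lintegral_stepSum μ hsup, ENNReal.tsum_eq_iSup_sum]
        refine iSup_le fun s => ?_
        simp_rw [measure_lt_iSup_of_directed μ hg hdir, ENNReal.mul_iSup]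
        rw [ENNReal.finsetSum_iSup]
        · refine iSup_mono fun i => ?_
          calc _ ≤ ∑' k : ℕ, δ * μ {x | (k + 1) * δ < g i x} := ENNReal.sum_le_tsum _
            _ = ∫⁻ x, stepSum δ (g i x) ∂μ := (lintegral_stepSum μ (hg i).measurable δ).symm
            _ ≤ ∫⁻ x, g i x ∂μ := lintegral_mono fun x => stepSum_le _ _
        · intro i j
          obtain ⟨k, hik, hjk⟩ := hdir i j
          refine ⟨k, fun a => ⟨?_, ?_⟩⟩
          · gcongr with x; exact hik x
          · gcongr with x; exact hjk x

/-- A finite supremum of multiples of indicators of open rectangles. -/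
def rectFun {X : Type*} [TopologicalSpace X]
    (s : Finset (NNReal × TopologicalSpace.Opens X × TopologicalSpace.Opens X)) (x y : X) : ℝ≥0∞ :=
  open Classical in s.sup fun r => if x ∈ r.2.1 ∧ y ∈ r.2.2 then (r.1 : ℝ≥0∞) else 0

omit [MeasurableSpace X] [BorelSpace X] in
lemma eventually_rectFun_le_left
    (s : Finset (NNReal × TopologicalSpace.Opens X × TopologicalSpace.Opens X)) (x : X) :
    ∀ᶠ x' in 𝓝 x, ∀ y, rectFun s x y ≤ rectFun s x' y := by
  classical
  have : ∀ᶠ x' in 𝓝 x, ∀ r ∈ s, x ∈ r.2.1 → x' ∈ r.2.1 := by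
    refine (Filter.eventually_all_finset s).2 fun r _ => ?_
    by_cases hx : x ∈ r.2.1
    · filter_upwards [r.2.1.isOpen.mem_nhds hx] with x' hx' _ using hx'
    · exact Eventually.of_forall fun _ h => absurd h hx
  filter_upwards [this] with x' hx' y
  refine Finset.sup_mono_fun fun r hr => ?_
  by_cases h : x ∈ r.2.1 ∧ y ∈ r.2.2
  · rw [if_pos h, if_pos ⟨hx' r hr h.1, h.2⟩]
  · rw [if_neg h]; exact zero_le

omit [MeasurableSpace X] [BorelSpace X] in
lemma lowerSemicontinuous_rectFun_right
    (s : Finset (NNReal × TopologicalSpace.Opens X × TopologicalSpace.Opens X)) (x : X) :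
    LowerSemicontinuous (rectFun s x) := by
  classical
  intro y t ht
  have : ∀ᶠ y' in 𝓝 y, ∀ r ∈ s, y ∈ r.2.2 → y' ∈ r.2.2 := by
    refine (Filter.eventually_all_finset s).2 fun r _ => ?_
    by_cases hy : y ∈ r.2.2
    · filter_upwards [r.2.2.isOpen.mem_nhds hy] with y' hy' _ using hy'
    · exact Eventually.of_forall fun _ h => absurd h hy
  filter_upwards [this] with y' hy'
  refine lt_of_lt_of_le ht (Finset.sup_mono_fun fun r hr => ?_)
  by_cases h : x ∈ r.2.1 ∧ y ∈ r.2.2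
  · rw [if_pos h, if_pos ⟨h.1, hy' r hr h.2⟩]
  · rw [if_neg h]; exact zero_le

lemma measurable_rectFun
    (s : Finset (NNReal × TopologicalSpace.Opens X × TopologicalSpace.Opens X)) :
    Measurable fun p : X × X => rectFun s p.1 p.2 := by
  classical
  unfold rectFun
  induction s using Finset.induction_on with
  | empty => simp
  | insert r s _ ih =>
    simp only [Finset.sup_insert]
    refine Measurable.sup (Measurable.ite ?_ measurable_const measurable_const) ih
    exact r.2.1.isOpen.measurableSet.prod r.2.2.isOpen.measurableSet

/-- Finite families of open rectangles whose associated function is dominated by `κ`. -/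
abbrev RectMinorant {X : Type*} [TopologicalSpace X] (κ : X → X → ℝ≥0∞) :=
  {s : Finset (NNReal × TopologicalSpace.Opens X × TopologicalSpace.Opens X) //
    ∀ x y, rectFun s x y ≤ κ x y}

omit [MeasurableSpace X] [BorelSpace X] in
lemma directed_rectFun (κ : X → X → ℝ≥0∞) :
    ∀ s t : RectMinorant κ, ∃ u : RectMinorant κ,
      ∀ x y, rectFun s.1 x y ≤ rectFun u.1 x y ∧ rectFun t.1 x y ≤ rectFun u.1 x y := by
  classical
  intro s t
  refine ⟨⟨s.1 ∪ t.1, fun x y => ?_⟩, fun x y => ⟨?_, ?_⟩⟩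
  · unfold rectFun
    rw [Finset.sup_union]
    exact sup_le (s.2 x y) (t.2 x y)
  · exact Finset.sup_mono Finset.subset_union_left
  · exact Finset.sup_mono Finset.subset_union_right

omit [MeasurableSpace X] [BorelSpace X] in
lemma iSup_rectFun {κ : X → X → ℝ≥0∞}
    (hκ : LowerSemicontinuous fun p : X × X => κ p.1 p.2) (x y : X) :
    ⨆ s : RectMinorant κ, rectFun s.1 x y = κ x y := by
  classical
  refine le_antisymm (iSup_le fun s => s.2 x y) (le_of_forall_lt fun t ht => ?_)
  obtain ⟨t', htt', ht'⟩ := exists_between ht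
  lift t' to NNReal using ne_top_of_lt ht'
  obtain ⟨U, V, hU, hxU, hV, hyV, hUV⟩ := mem_nhds_prod_iff'.1 (hκ (x, y) t' ht')
  refine lt_of_lt_of_le htt' (le_iSup_of_le ⟨{(t', ⟨U, hU⟩, ⟨V, hV⟩)}, fun a b => ?_⟩ ?_)
  · unfold rectFun
    rw [Finset.sup_singleton]
    split_ifs with h
    · exact (hUV (show (a, b) ∈ U ×ˢ V from h)).le
    · exact zero_le
  · unfold rectFun
    rw [Finset.sup_singleton, if_pos ⟨hxU, hyV⟩]

lemma potential_eq_iSup {κ : X → X → ℝ≥0∞}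
    (hκ : LowerSemicontinuous fun p : X × X => κ p.1 p.2) (ν : Measure X) [ν.Regular] (x : X) :
    potential κ ν x = ⨆ s : RectMinorant κ, ∫⁻ y, rectFun s.1 x y ∂ν := by
  unfold potential
  simp_rw [← iSup_rectFun hκ]
  refine lintegral_iSup_of_lowerSemicontinuous ν
    (fun s => lowerSemicontinuous_rectFun_right s.1 x) fun s t => ?_
  obtain ⟨u, hu⟩ := directed_rectFun κ s t
  exact ⟨u, fun y => (hu x y).1, fun y => (hu x y).2⟩

omit [BorelSpace X] in
lemma lowerSemicontinuous_lintegral_rectFun (ν : Measure X)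
    (s : Finset (NNReal × TopologicalSpace.Opens X × TopologicalSpace.Opens X)) :
    LowerSemicontinuous fun x => ∫⁻ y, rectFun s x y ∂ν := by
  intro x t ht
  filter_upwards [eventually_rectFun_le_left s x] with x' hx'
  exact lt_of_lt_of_le ht (lintegral_mono hx')

lemma lowerSemicontinuous_potential {κ : X → X → ℝ≥0∞}
    (hκ : LowerSemicontinuous fun p : X × X => κ p.1 p.2) (ν : Measure X) [ν.Regular] :
    LowerSemicontinuous (potential κ ν) := by
  have : potential κ ν = fun x => ⨆ s : RectMinorant κ, ∫⁻ y, rectFun s.1 x y ∂ν :=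
    funext (potential_eq_iSup hκ ν)
  rw [this]
  exact lowerSemicontinuous_iSup fun s => lowerSemicontinuous_lintegral_rectFun ν s.1

/-- Tonelli's theorem for a lower semicontinuous kernel. -/
theorem lintegral_potential {κ : X → X → ℝ≥0∞}
    (hκ : LowerSemicontinuous fun p : X × X => κ p.1 p.2) (μ ν : Measure X) [μ.Regular]
    [ν.Regular] [SFinite ν] :
    ∫⁻ x, potential κ ν x ∂μ = mutualEnergy κ μ ν := by
  refine le_antisymm ?_ (lintegral_prod_le _)
  simp_rw [potential_eq_iSup hκ]
  rw [lintegral_iSup_of_lowerSemicontinuous μ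
    (fun s : RectMinorant κ => lowerSemicontinuous_lintegral_rectFun ν s.1)]
  · refine iSup_le fun s => ?_
    rw [← lintegral_prod _ (measurable_rectFun s.1).aemeasurable]
    exact lintegral_mono fun p => s.2 p.1 p.2
  · intro s t
    obtain ⟨u, hu⟩ := directed_rectFun κ s t
    exact ⟨u, fun x => lintegral_mono fun y => (hu x y).1,
      fun x => lintegral_mono fun y => (hu x y).2⟩

/-- Open sets of finite measure. -/
abbrev FiniteOpens (μ : Measure X) := {V : TopologicalSpace.Opens X // μ V < ⊤}

omit [BorelSpace X] in
lemma directed_finiteOpens (μ : Measure X) :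
    ∀ V W : FiniteOpens μ, ∃ U : FiniteOpens μ, V.1 ≤ U.1 ∧ W.1 ≤ U.1 := fun V W =>
  ⟨⟨V.1 ⊔ W.1, (measure_union_le _ _).trans_lt (ENNReal.add_lt_top.2 ⟨V.2, W.2⟩)⟩,
    le_sup_left, le_sup_right⟩

lemma lintegral_eq_iSup_finiteOpens [T2Space X] [LocallyCompactSpace X] (μ : Measure X)
    [μ.Regular] {g : X → ℝ≥0∞} (hg : LowerSemicontinuous g) :
    ∫⁻ x, g x ∂μ = ⨆ V : FiniteOpens μ, ∫⁻ x in V.1, g x ∂μ := by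
  have h1 : ∀ x, g x = ⨆ V : FiniteOpens μ, (V.1 : Set X).indicator g x := by
    intro x
    refine le_antisymm ?_ (iSup_le fun V => indicator_le_self _ _ _)
    obtain ⟨V, hxV, hV, hμ⟩ := μ.exists_isOpen_measure_lt_top x
    refine le_iSup_of_le ⟨⟨V, hV⟩, hμ⟩ ?_
    simp [hxV]
  calc ∫⁻ x, g x ∂μ = ∫⁻ x, ⨆ V : FiniteOpens μ, (V.1 : Set X).indicator g x ∂μ :=
        lintegral_congr h1
    _ = ⨆ V : FiniteOpens μ, ∫⁻ x, (V.1 : Set X).indicator g x ∂μ := by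
        refine lintegral_iSup_of_lowerSemicontinuous μ (fun V x t ht => ?_) fun V W => ?_
        · beta_reduce at ht ⊢
          by_cases hx : x ∈ (V.1 : Set X)
          · rw [indicator_of_mem hx] at ht
            filter_upwards [V.1.isOpen.mem_nhds hx, hg x t ht] with y hy hty
            rwa [indicator_of_mem hy]
          · simp [indicator_of_notMem hx] at ht
        · obtain ⟨U, hVU, hWU⟩ := directed_finiteOpens μ V W
          exact ⟨U, fun x => indicator_le_indicator_of_subset hVU (fun _ => zero_le) x,
            fun x => indicator_le_indicator_of_subset hWU (fun _ => zero_le) x⟩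
    _ = _ := by simp_rw [lintegral_indicator (TopologicalSpace.Opens.isOpen _).measurableSet]

lemma lintegral_potential_eq_iSup [T2Space X] [LocallyCompactSpace X] {κ : X → X → ℝ≥0∞}
    (hκ : LowerSemicontinuous fun p : X × X => κ p.1 p.2) (μ ν : Measure X) [μ.Regular]
    [ν.Regular] :
    ∫⁻ x, potential κ ν x ∂μ = ⨆ V : FiniteOpens ν, mutualEnergy κ μ (ν.restrict V.1) := by
  have hreg : ∀ V : FiniteOpens ν, (ν.restrict (V.1 : Set X)).Regular := fun V =>
    Measure.Regular.restrict_of_measure_ne_top V.2.ne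
  have hfin : ∀ V : FiniteOpens ν, IsFiniteMeasure (ν.restrict (V.1 : Set X)) := fun V =>
    ⟨by simpa using V.2⟩
  have h1 : ∀ x, potential κ ν x = ⨆ V : FiniteOpens ν, potential κ (ν.restrict V.1) x := fun x =>
    lintegral_eq_iSup_finiteOpens ν
      (hκ.comp (by fun_prop : Continuous fun y : X => (x, y)))
  simp_rw [h1, ← lintegral_potential hκ]
  refine lintegral_iSup_of_lowerSemicontinuous μ
    (fun V => lowerSemicontinuous_potential hκ _) fun V W => ?_
  obtain ⟨U, hVU, hWU⟩ := directed_finiteOpens ν V W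
  exact ⟨U, fun x => lintegral_mono' (Measure.restrict_mono_set _ hVU) le_rfl,
    fun x => lintegral_mono' (Measure.restrict_mono_set _ hWU) le_rfl⟩

omit [BorelSpace X] in
lemma energy_restrict_le {κ : X → X → ℝ≥0∞} (hE : EnergyPrinciple κ) {μ : Measure X}
    (hμ : memEplus κ μ) {s : Set X} (hs : μ s < ⊤) :
    energy κ (μ.restrict s) ≤ energy κ μ := by
  have : IsFiniteMeasure (μ.restrict s) := ⟨by simpa using hs⟩
  by_cases hm : AEMeasurable (fun x : X => Measure.map (Prod.mk x) μ) μ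
  · refine lintegral_mono' (Measure.le_iff.2 fun t ht => ?_) le_rfl
    rw [Measure.prod_apply ht, Measure.prod_def, Measure.bind_apply ht hm]
    refine lintegral_mono' Measure.restrict_le_self fun x => ?_
    rw [Measure.map_apply measurable_prodMk_left ht]
    exact Measure.restrict_apply_le _ _
  · exfalso
    have h0 : μ.prod μ = 0 := by
      rw [Measure.prod_def, Measure.bind, Measure.map_of_not_aemeasurable hm, Measure.join_zero]
    have hμ0 : energy κ μ = 0 := by simp [energy, mutualEnergy, h0]
    have hz : energy κ (0 : Measure X) = 0 := by simp [energy, mutualEnergy]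
    have hz' : mutualEnergy κ 0 μ = 0 := by
      simp [mutualEnergy, Measure.prod_def, Measure.bind]
    have hreg : (0 : Measure X).Regular := inferInstance
    have := (hE 0 μ ⟨hreg, by simp [hz]⟩ hμ).2 (by rw [hz', hμ0, hz]; simp)
    subst this
    exact hm (aemeasurable_zero_measure)

/-- The measure `μ` is finite, Radon, and has finite energy. -/
structure FinEnergy (κ : X → X → ℝ≥0∞) (μ : Measure X) : Prop where
  finite : IsFiniteMeasure μ
  memEplus : memEplus κ μ

/-- The real-valued mutual energy. -/
def realEnergy (κ : X → X → ℝ≥0∞) (μ ν : Measure X) : ℝ := (mutualEnergy κ μ ν).toReal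

/-- The squared energy distance. -/
def sqDist (κ : X → X → ℝ≥0∞) (μ ν : Measure X) : ℝ :=
  realEnergy κ μ μ + realEnergy κ ν ν - 2 * realEnergy κ μ ν

omit [BorelSpace X] [TopologicalSpace X] in
lemma strongDist_eq (κ : X → X → ℝ≥0∞) (μ ν : Measure X) :
    strongDist κ μ ν = √(sqDist κ μ ν) := rfl

omit [BorelSpace X] [TopologicalSpace X] in
lemma realEnergy_nonneg (κ : X → X → ℝ≥0∞) (μ ν : Measure X) : 0 ≤ realEnergy κ μ ν :=
  ENNReal.toReal_nonneg

section Energy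

variable {κ : X → X → ℝ≥0∞}

omit [BorelSpace X] in
lemma mutualEnergy_le_add (hE : EnergyPrinciple κ) {μ ν : Measure X} (hμ : memEplus κ μ)
    (hν : memEplus κ ν) : mutualEnergy κ μ ν ≤ energy κ μ + energy κ ν :=
  le_trans (by rw [two_mul]; exact le_self_add) (hE μ ν hμ hν).1

omit [BorelSpace X] in
lemma mutualEnergy_lt_top (hE : EnergyPrinciple κ) {μ ν : Measure X} (hμ : memEplus κ μ)
    (hν : memEplus κ ν) : mutualEnergy κ μ ν < ⊤ :=
  (mutualEnergy_le_add hE hμ hν).trans_lt (ENNReal.add_lt_top.2 ⟨hμ.2, hν.2⟩)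

omit [BorelSpace X] in
lemma sqDist_nonneg (hE : EnergyPrinciple κ) {μ ν : Measure X} (hμ : memEplus κ μ)
    (hν : memEplus κ ν) : 0 ≤ sqDist κ μ ν := by
  have h := ENNReal.toReal_mono (ENNReal.add_lt_top.2 ⟨hμ.2, hν.2⟩).ne (hE μ ν hμ hν).1
  rw [ENNReal.toReal_add hμ.2.ne hν.2.ne, ENNReal.toReal_mul, ENNReal.toReal_ofNat] at h
  exact sub_nonneg.2 h

omit [BorelSpace X] in
lemma eq_of_sqDist_le_zero (hE : EnergyPrinciple κ) {μ ν : Measure X} (hμ : memEplus κ μ)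
    (hν : memEplus κ ν) (h : sqDist κ μ ν ≤ 0) : μ = ν := by
  refine (hE μ ν hμ hν).2 (le_antisymm (hE μ ν hμ hν).1 ?_)
  have hfin : 2 * mutualEnergy κ μ ν ≠ ⊤ :=
    ENNReal.mul_ne_top (by simp) (mutualEnergy_lt_top hE hμ hν).ne
  rw [← ENNReal.toReal_le_toReal (ENNReal.add_lt_top.2 ⟨hμ.2, hν.2⟩).ne hfin,
    ENNReal.toReal_add hμ.2.ne hν.2.ne, ENNReal.toReal_mul, ENNReal.toReal_ofNat]
  exact sub_nonpos.1 h

omit [BorelSpace X] in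
lemma mutualEnergy_comm (hker : IsKernel κ) (μ ν : Measure X) [SFinite μ] [SFinite ν] :
    mutualEnergy κ μ ν = mutualEnergy κ ν μ := by
  unfold mutualEnergy
  rw [← lintegral_prod_swap]
  exact lintegral_congr fun p => hker.1 _ _

omit [BorelSpace X] in
lemma realEnergy_comm (hker : IsKernel κ) (μ ν : Measure X) [SFinite μ] [SFinite ν] :
    realEnergy κ μ ν = realEnergy κ ν μ := by
  unfold realEnergy
  rw [mutualEnergy_comm hker]

omit [BorelSpace X] [TopologicalSpace X] in
lemma mutualEnergy_add_left (μ μ' ν : Measure X) [SFinite μ] [SFinite μ'] [SFinite ν] :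
    mutualEnergy κ (μ + μ') ν = mutualEnergy κ μ ν + mutualEnergy κ μ' ν := by
  unfold mutualEnergy
  rw [Measure.add_prod, lintegral_add_measure]

omit [BorelSpace X] [TopologicalSpace X] in
lemma mutualEnergy_smul_left (c : NNReal) (μ ν : Measure X) [SFinite ν] :
    mutualEnergy κ (c • μ) ν = c * mutualEnergy κ μ ν := by
  unfold mutualEnergy
  rw [Measure.prod_smul_left, lintegral_smul_measure]
  rfl

omit [BorelSpace X] in
lemma mutualEnergy_add_right (hker : IsKernel κ) (μ ν ν' : Measure X) [SFinite μ] [SFinite ν]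
    [SFinite ν'] :
    mutualEnergy κ μ (ν + ν') = mutualEnergy κ μ ν + mutualEnergy κ μ ν' := by
  rw [mutualEnergy_comm hker, mutualEnergy_add_left, mutualEnergy_comm hker ν,
    mutualEnergy_comm hker ν']

omit [BorelSpace X] in
lemma mutualEnergy_smul_right (hker : IsKernel κ) (c : NNReal) (μ ν : Measure X) [SFinite μ]
    [SFinite ν] : mutualEnergy κ μ (c • ν) = c * mutualEnergy κ μ ν := by
  rw [mutualEnergy_comm hker, mutualEnergy_smul_left, mutualEnergy_comm hker]

lemma FinEnergy.add [T2Space X] (hker : IsKernel κ) (hE : EnergyPrinciple κ) {μ ν : Measure X}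
    (hμ : FinEnergy κ μ) (hν : FinEnergy κ ν) : FinEnergy κ (μ + ν) := by
  have := hμ.finite
  have := hν.finite
  have : μ.Regular := hμ.memEplus.1
  have : ν.Regular := hν.memEplus.1
  have hreg : (μ + ν).Regular := inferInstance
  refine ⟨inferInstance, hreg, ?_⟩
  have h1 := mutualEnergy_lt_top hE hμ.memEplus hμ.memEplus
  have h2 := mutualEnergy_lt_top hE hμ.memEplus hν.memEplus
  have h3 := mutualEnergy_lt_top hE hν.memEplus hμ.memEplus
  have h4 := mutualEnergy_lt_top hE hν.memEplus hν.memEplus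
  unfold energy
  rw [mutualEnergy_add_left, mutualEnergy_add_right hker, mutualEnergy_add_right hker]
  exact ENNReal.add_lt_top.2 ⟨ENNReal.add_lt_top.2 ⟨h1, h2⟩, ENNReal.add_lt_top.2 ⟨h3, h4⟩⟩

omit [BorelSpace X] in
lemma FinEnergy.smul (hker : IsKernel κ) {μ : Measure X} (hμ : FinEnergy κ μ) (c : NNReal) :
    FinEnergy κ (c • μ) := by
  have := hμ.finite
  have : μ.Regular := hμ.memEplus.1
  have hreg : (c • μ).Regular := inferInstance
  refine ⟨inferInstance, hreg, ?_⟩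
  unfold energy
  rw [mutualEnergy_smul_left, mutualEnergy_smul_right hker]
  exact ENNReal.mul_lt_top ENNReal.coe_lt_top (ENNReal.mul_lt_top ENNReal.coe_lt_top hμ.memEplus.2)

omit [BorelSpace X] in
lemma realEnergy_add_left (hE : EnergyPrinciple κ) {μ μ' ν : Measure X} (hμ : FinEnergy κ μ)
    (hμ' : FinEnergy κ μ') (hν : FinEnergy κ ν) :
    realEnergy κ (μ + μ') ν = realEnergy κ μ ν + realEnergy κ μ' ν := by
  have := hμ.finite
  have := hμ'.finite
  have := hν.finite
  unfold realEnergy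
  rw [mutualEnergy_add_left, ENNReal.toReal_add (mutualEnergy_lt_top hE hμ.memEplus hν.memEplus).ne
    (mutualEnergy_lt_top hE hμ'.memEplus hν.memEplus).ne]

omit [BorelSpace X] [TopologicalSpace X] in
lemma realEnergy_smul_left (c : NNReal) (μ ν : Measure X) [SFinite ν] :
    realEnergy κ (c • μ) ν = c * realEnergy κ μ ν := by
  unfold realEnergy
  rw [mutualEnergy_smul_left, ENNReal.toReal_mul, ENNReal.coe_toReal]

omit [BorelSpace X] in
lemma realEnergy_add_self (hker : IsKernel κ) (hE : EnergyPrinciple κ) {μ ν : Measure X}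
    (hμ : FinEnergy κ μ) (hν : FinEnergy κ ν) :
    realEnergy κ (μ + ν) (μ + ν) =
      realEnergy κ μ μ + 2 * realEnergy κ μ ν + realEnergy κ ν ν := by
  have := hμ.finite
  have := hν.finite
  have h1 := (mutualEnergy_lt_top hE hμ.memEplus hμ.memEplus).ne
  have h2 := (mutualEnergy_lt_top hE hμ.memEplus hν.memEplus).ne
  have h3 := (mutualEnergy_lt_top hE hν.memEplus hμ.memEplus).ne
  have h4 := (mutualEnergy_lt_top hE hν.memEplus hν.memEplus).ne
  have hc := realEnergy_comm hker μ ν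
  unfold realEnergy at *
  rw [mutualEnergy_add_left, mutualEnergy_add_right hker, mutualEnergy_add_right hker,
    ENNReal.toReal_add (by finiteness) (by finiteness), ENNReal.toReal_add h1 h2,
    ENNReal.toReal_add h3 h4, ← hc]
  ring

omit [BorelSpace X] in
lemma realEnergy_smul_self (hker : IsKernel κ) (c : NNReal) (μ : Measure X) [IsFiniteMeasure μ] :
    realEnergy κ (c • μ) (c • μ) = c ^ 2 * realEnergy κ μ μ := by
  rw [realEnergy_smul_left, realEnergy_comm hker, realEnergy_smul_left]
  ring

/-- A quantitative Cauchy–Schwarz inequality in the cone of measures of finite energy. -/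
lemma realEnergy_le_add [T2Space X] (hker : IsKernel κ) (hE : EnergyPrinciple κ)
    {μ ν σ : Measure X} (hμ : FinEnergy κ μ) (hν : FinEnergy κ ν) (hσ : FinEnergy κ σ) {t : ℝ}
    (ht : 0 < t) :
    realEnergy κ μ σ ≤ realEnergy κ ν σ + (sqDist κ μ ν / t + t * realEnergy κ σ σ) / 2 := by
  have := hμ.finite
  have := hν.finite
  have := hσ.finite
  lift t to NNReal using ht.le
  have htσ := hσ.smul hker t
  have h := sqDist_nonneg hE (htσ.add hker hE hν).memEplus hμ.memEplus
  unfold sqDist at h ⊢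
  rw [realEnergy_add_self hker hE htσ hν, realEnergy_add_left hE htσ hν hμ,
    realEnergy_smul_self hker, realEnergy_smul_left, realEnergy_smul_left,
    realEnergy_comm hker σ ν, realEnergy_comm hker σ μ, realEnergy_comm hker ν μ] at h
  rw [← sub_nonneg]
  refine nonneg_of_mul_nonneg_right (a := 2 * (t : ℝ)) ?_ (by positivity)
  have ht' : (t : ℝ) ≠ 0 := ht.ne'
  field_simp
  linarith

lemma FinEnergy.restrict [T2Space X] (hE : EnergyPrinciple κ) {μ : Measure X}
    (hμ : GaussVar.memEplus κ μ) {s : Set X} (hs : μ s < ⊤) : FinEnergy κ (μ.restrict s) := by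
  have : μ.Regular := hμ.1
  have hreg : (μ.restrict s).Regular := Measure.Regular.restrict_of_measure_ne_top hs.ne
  exact ⟨⟨by simpa using hs⟩, hreg, (energy_restrict_le hE hμ hs).trans_lt hμ.2⟩

variable [T2Space X] [LocallyCompactSpace X]

lemma lintegral_potential_lt_top (hker : IsKernel κ) (hE : EnergyPrinciple κ) {μ θ : Measure X}
    (hμ : FinEnergy κ μ) (hθ : memEplus κ θ) : ∫⁻ x, potential κ θ x ∂μ < ⊤ := by
  have : μ.Regular := hμ.memEplus.1
  have : θ.Regular := hθ.1
  rw [lintegral_potential_eq_iSup hker.2]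
  refine lt_of_le_of_lt (iSup_le fun V => ?_) (ENNReal.add_lt_top.2 ⟨hμ.memEplus.2, hθ.2⟩)
  exact (mutualEnergy_le_add hE hμ.memEplus (FinEnergy.restrict hE hθ V.2).memEplus).trans
    (add_le_add le_rfl (energy_restrict_le hE hθ V.2))

lemma toReal_lintegral_potential_le_add (hker : IsKernel κ) (hE : EnergyPrinciple κ)
    {μ ν θ : Measure X} (hμ : FinEnergy κ μ) (hν : FinEnergy κ ν) (hθ : memEplus κ θ) {t : ℝ}
    (ht : 0 < t) :
    (∫⁻ x, potential κ θ x ∂μ).toReal ≤ (∫⁻ x, potential κ θ x ∂ν).toReal +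
      (sqDist κ μ ν / t + t * (energy κ θ).toReal) / 2 := by
  have : μ.Regular := hμ.memEplus.1
  have : ν.Regular := hν.memEplus.1
  have : θ.Regular := hθ.1
  have hD := sqDist_nonneg hE hμ.memEplus hν.memEplus
  have hfin := lintegral_potential_lt_top hker hE hν hθ
  refine ENNReal.toReal_le_of_le_ofReal (by positivity) ?_
  rw [lintegral_potential_eq_iSup hker.2 μ]
  refine iSup_le fun V => ?_
  have hV := FinEnergy.restrict hE hθ V.2
  rw [ENNReal.le_ofReal_iff_toReal_le (mutualEnergy_lt_top hE hμ.memEplus hV.memEplus).ne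
    (by positivity)]
  refine (realEnergy_le_add hker hE hμ hν hV ht).trans ?_
  have h1 : realEnergy κ ν (θ.restrict V.1) ≤ (∫⁻ x, potential κ θ x ∂ν).toReal := by
    refine ENNReal.toReal_mono hfin.ne ?_
    rw [lintegral_potential_eq_iSup hker.2 ν]
    exact le_iSup (fun V : FiniteOpens θ => mutualEnergy κ ν (θ.restrict V.1)) V
  have h2 : realEnergy κ (θ.restrict V.1) (θ.restrict V.1) ≤ (energy κ θ).toReal :=
    ENNReal.toReal_mono hθ.2.ne (energy_restrict_le hE hθ V.2)
  gcongr

end Energy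

lemma tendsto_of_sub_le_add {a D : ℕ → ℝ} {l M : ℝ} (hM : 0 ≤ M) (hD : Tendsto D atTop (𝓝 0))
    (h1 : ∀ n t, 0 < t → a n ≤ l + (D n / t + t * M) / 2)
    (h2 : ∀ n t, 0 < t → l ≤ a n + (D n / t + t * M) / 2) : Tendsto a atTop (𝓝 l) := by
  rw [Metric.tendsto_atTop']
  intro ε hε
  have ht : 0 < ε / (M + 1) := by positivity
  have htM : ε / (M + 1) * M ≤ ε := by
    rw [div_mul_eq_mul_div, div_le_iff₀ (by positivity)]
    nlinarith
  have hev := (hD.div_const (ε / (M + 1))).eventually_lt_const (u := ε) (by simpa using hε)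
  obtain ⟨N, hN⟩ := eventually_atTop.1 hev
  refine ⟨N, fun n hn => ?_⟩
  rw [Real.dist_eq, abs_lt]
  have := hN n hn.le
  constructor
  · linarith [h2 n _ ht]
  · linarith [h1 n _ ht]

omit [BorelSpace X] in
lemma sqDist_comm {κ : X → X → ℝ≥0∞} (hker : IsKernel κ) (μ ν : Measure X) [SFinite μ]
    [SFinite ν] : sqDist κ μ ν = sqDist κ ν μ := by
  unfold sqDist
  rw [realEnergy_comm hker μ ν]
  ring

lemma tendsto_lintegral_potential [T2Space X] [LocallyCompactSpace X] {κ : X → X → ℝ≥0∞}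
    (hker : IsKernel κ) (hE : EnergyPrinciple κ) {μ : ℕ → Measure X} {ν θ : Measure X}
    (hμ : ∀ n, FinEnergy κ (μ n)) (hν : FinEnergy κ ν) (hθ : memEplus κ θ)
    (h : Tendsto (fun n => sqDist κ (μ n) ν) atTop (𝓝 0)) :
    Tendsto (fun n => (∫⁻ x, potential κ θ x ∂(μ n)).toReal) atTop
      (𝓝 (∫⁻ x, potential κ θ x ∂ν).toReal) := by
  refine tendsto_of_sub_le_add ENNReal.toReal_nonneg h
    (fun n t ht => toReal_lintegral_potential_le_add hker hE (hμ n) hν hθ ht) fun n t ht => ?_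
  have := (hμ n).finite
  have := hν.finite
  rw [sqDist_comm hker]
  exact toReal_lintegral_potential_le_add hker hE hν (hμ n) hθ ht

lemma tendsto_realEnergy_self [T2Space X] {κ : X → X → ℝ≥0∞}
    (hker : IsKernel κ) (hE : EnergyPrinciple κ) {μ : ℕ → Measure X} {ν : Measure X}
    (hμ : ∀ n, FinEnergy κ (μ n)) (hν : FinEnergy κ ν)
    (h : Tendsto (fun n => sqDist κ (μ n) ν) atTop (𝓝 0)) :
    Tendsto (fun n => realEnergy κ (μ n) (μ n)) atTop (𝓝 (realEnergy κ ν ν)) := by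
  have h1 : Tendsto (fun n => realEnergy κ (μ n) ν) atTop (𝓝 (realEnergy κ ν ν)) := by
    refine tendsto_of_sub_le_add (realEnergy_nonneg κ ν ν) h
      (fun n t ht => realEnergy_le_add hker hE (hμ n) hν hν ht) fun n t ht => ?_
    have := (hμ n).finite
    have := hν.finite
    rw [sqDist_comm hker]
    exact realEnergy_le_add hker hE hν (hμ n) hν ht
  have h2 := (h.sub_const (realEnergy κ ν ν)).add (h1.const_mul 2)
  convert h2 using 1
  · funext n; unfold sqDist; ring
  · congr 1; ring

section Field

variable {κ : X → X → ℝ≥0∞} {f : X → EReal}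

lemma exists_add_real_nonneg {X : Type*} [TopologicalSpace X] {ψ : X → EReal}
    (hψ : LowerSemicontinuous ψ) (hbot : ∀ x, ψ x ≠ ⊥)
    (hpos : ¬ CompactSpace X → ∀ x, 0 ≤ ψ x) : ∃ b : ℝ, ∀ x, 0 ≤ ψ x + b := by
  by_cases hX : CompactSpace X
  · rcases isEmpty_or_nonempty X with h | h
    · exact ⟨0, fun x => h.elim x⟩
    obtain ⟨a, -, ha⟩ := LowerSemicontinuousOn.exists_isMinOn univ_nonempty isCompact_univ
      (hψ.lowerSemicontinuousOn univ)
    obtain ⟨c, -, hc⟩ := EReal.lt_iff_exists_real_btwn.1 (bot_lt_iff_ne_bot.2 (hbot a))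
    refine ⟨-c, fun x => ?_⟩
    have hcx : (c : EReal) ≤ ψ x := hc.le.trans (ha (mem_univ x))
    calc (0 : EReal) = (c : EReal) + ((-c : ℝ) : EReal) := by
          rw [← EReal.coe_add, add_neg_cancel, EReal.coe_zero]
      _ ≤ ψ x + ((-c : ℝ) : EReal) := by gcongr
  · exact ⟨0, fun x => by simpa using hpos hX x⟩

/-- Normal form of an external field: the lower semicontinuous part is written as a nonnegative
function minus a constant. -/
structure FieldData (κ : X → X → ℝ≥0∞) (f : X → EReal) where
  /-- The shifted lower semicontinuous part. -/
  g : X → ℝ≥0∞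
  /-- The shift. -/
  b : ℝ
  /-- The charge with positive sign. -/
  θp : Measure X
  /-- The charge with negative sign. -/
  θm : Measure X
  lsc : LowerSemicontinuous g
  memp : memEplus κ θp
  memm : memEplus κ θm
  eq : ∀ x, f x = ((g x : EReal) - (b : EReal)) + (potential κ θp x : EReal)
    - (potential κ θm x : EReal)

omit [BorelSpace X] in
lemma IsExternalField.nonempty_fieldData (hf : IsExternalField κ f) :
    Nonempty (FieldData κ f) := by
  obtain ⟨ψ, θp, θm, hψ, hbot, hpos, hp, hm, heq⟩ := hf
  obtain ⟨b, hb⟩ := exists_add_real_nonneg hψ hbot hpos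
  refine ⟨⟨fun x => (ψ x + b).toENNReal, b, θp, θm, ?_, hp, hm, fun x => ?_⟩⟩
  · have hmono : Monotone fun z : EReal => (z + b).toENNReal := fun y z hyz =>
      EReal.toENNReal_le_toENNReal (by gcongr)
    have hcont : Continuous fun z : EReal => (z + b).toENNReal := by
      refine EReal.continuous_toENNReal.comp (continuous_iff_continuousAt.2 fun z => ?_)
      have hadd := EReal.continuousAt_add (p := (z, (b : EReal))) (by simp) (by simp)
      have hpair : ContinuousAt (fun z : EReal => (z, (b : EReal))) z := by fun_prop
      exact ContinuousAt.comp (f := fun z : EReal => (z, (b : EReal))) hadd hpair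
    exact hcont.comp_lowerSemicontinuous hψ hmono
  · rw [heq, EReal.coe_toENNReal (hb x)]
    congr 2
    induction h : ψ x with
    | bot => exact absurd h (hbot x)
    | coe r => norm_cast; ring
    | top => simp

lemma field_value {g u v : ℝ≥0∞} {b : ℝ} (hu : u < ⊤) (hv : v < ⊤) :
    ((((g : EReal) - (b : EReal)) + (u : EReal) - (v : EReal) ≠ ⊤) ↔ g < ⊤) ∧
      (((g : EReal) - (b : EReal)) + (u : EReal) - (v : EReal) ≠ ⊥) ∧
      (g < ⊤ → (((g : EReal) - (b : EReal)) + (u : EReal) - (v : EReal)).toReal =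
        g.toReal - b + u.toReal - v.toReal) := by
  lift u to NNReal using hu.ne
  lift v to NNReal using hv.ne
  have hcoe : ∀ r : NNReal, (((r : ℝ≥0∞) : EReal)) = ((r : ℝ) : EReal) := fun r => rfl
  induction g with
  | top =>
    simp only [hcoe, EReal.coe_ennreal_top, EReal.top_sub_coe, EReal.top_add_coe]
    simp
  | coe g =>
    simp only [hcoe, ← EReal.coe_sub, ← EReal.coe_add]
    exact ⟨iff_of_true (EReal.coe_ne_top _) ENNReal.coe_lt_top, EReal.coe_ne_bot _, fun _ => rfl⟩

variable [T2Space X] [LocallyCompactSpace X]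

lemma FieldData.ae_lt_top (F : FieldData κ f) (hker : IsKernel κ) (hE : EnergyPrinciple κ)
    {μ : Measure X} (hμ : FinEnergy κ μ) :
    ∀ᵐ x ∂μ, potential κ F.θp x < ⊤ ∧ potential κ F.θm x < ⊤ := by
  have : F.θp.Regular := F.memp.1
  have : F.θm.Regular := F.memm.1
  have h1 := MeasureTheory.ae_lt_top (lowerSemicontinuous_potential hker.2 F.θp).measurable
    (lintegral_potential_lt_top hker hE hμ F.memp).ne
  have h2 := MeasureTheory.ae_lt_top (lowerSemicontinuous_potential hker.2 F.θm).measurable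
    (lintegral_potential_lt_top hker hE hμ F.memm).ne
  exact h1.and h2

lemma integrable_potential {θ : Measure X} (hker : IsKernel κ)
    (hE : EnergyPrinciple κ) {μ : Measure X} (hμ : FinEnergy κ μ) (hθ : memEplus κ θ) :
    Integrable (fun x => (potential κ θ x).toReal) μ := by
  have : θ.Regular := hθ.1
  exact integrable_toReal_of_lintegral_ne_top
    (lowerSemicontinuous_potential hker.2 θ).measurable.aemeasurable
    (lintegral_potential_lt_top hker hE hμ hθ).ne

lemma integral_potential {θ : Measure X} (hker : IsKernel κ)
    (hE : EnergyPrinciple κ) {μ : Measure X} (hμ : FinEnergy κ μ) (hθ : memEplus κ θ) :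
    ∫ x, (potential κ θ x).toReal ∂μ = (∫⁻ x, potential κ θ x ∂μ).toReal := by
  have : θ.Regular := hθ.1
  have hm := (lowerSemicontinuous_potential hker.2 θ).measurable
  exact integral_toReal hm.aemeasurable
    (ae_lt_top hm (lintegral_potential_lt_top hker hE hμ hθ).ne)

lemma FieldData.fieldIntegrable_iff (F : FieldData κ f) (hker : IsKernel κ)
    (hE : EnergyPrinciple κ) {μ : Measure X} (hμ : FinEnergy κ μ) :
    FieldIntegrable f μ ↔ ∫⁻ x, F.g x ∂μ < ⊤ := by
  have := hμ.finite
  have hp := integrable_potential hker hE hμ F.memp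
  have hm := integrable_potential hker hE hμ F.memm
  have hae := F.ae_lt_top hker hE hμ
  constructor
  · rintro ⟨hint, hfin⟩
    have hg : ∀ᵐ x ∂μ, F.g x < ⊤ := by
      filter_upwards [hfin, hae] with x hx hx'
      rw [F.eq x] at hx
      exact (field_value hx'.1 hx'.2).1.1 hx.1
    have hgi : Integrable (fun x => (F.g x).toReal) μ := by
      refine (((hint.add (integrable_const F.b)).sub hp).add hm).congr ?_
      filter_upwards [hg, hae] with x hx hx'
      simp only [Pi.add_apply, Pi.sub_apply]
      rw [F.eq x, (field_value hx'.1 hx'.2).2.2 hx]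
      ring
    calc ∫⁻ x, F.g x ∂μ = ∫⁻ x, ENNReal.ofReal (F.g x).toReal ∂μ :=
          lintegral_congr_ae (hg.mono fun x hx => (ENNReal.ofReal_toReal hx.ne).symm)
      _ < ⊤ := hgi.lintegral_lt_top
  · intro hlt
    have hg : ∀ᵐ x ∂μ, F.g x < ⊤ := MeasureTheory.ae_lt_top F.lsc.measurable hlt.ne
    have hgi := integrable_toReal_of_lintegral_ne_top F.lsc.measurable.aemeasurable hlt.ne
    refine ⟨(((hgi.sub (integrable_const F.b)).add hp).sub hm).congr ?_, ?_⟩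
    · filter_upwards [hg, hae] with x hx hx'
      simp only [Pi.add_apply, Pi.sub_apply]
      rw [F.eq x, (field_value hx'.1 hx'.2).2.2 hx]
    · filter_upwards [hg, hae] with x hx hx'
      rw [F.eq x]
      exact ⟨(field_value hx'.1 hx'.2).1.2 hx, (field_value hx'.1 hx'.2).2.1⟩

lemma FieldData.fieldIntegral_eq (F : FieldData κ f) (hker : IsKernel κ)
    (hE : EnergyPrinciple κ) {μ : Measure X} (hμ : FinEnergy κ μ) (hone : μ univ = 1)
    (hint : FieldIntegrable f μ) :
    fieldIntegral f μ = (∫⁻ x, F.g x ∂μ).toReal - F.b +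
      (∫⁻ x, potential κ F.θp x ∂μ).toReal - (∫⁻ x, potential κ F.θm x ∂μ).toReal := by
  have := hμ.finite
  have hp := integrable_potential hker hE hμ F.memp
  have hm := integrable_potential hker hE hμ F.memm
  have hlt := (F.fieldIntegrable_iff hker hE hμ).1 hint
  have hg : ∀ᵐ x ∂μ, F.g x < ⊤ := MeasureTheory.ae_lt_top F.lsc.measurable hlt.ne
  have hgi := integrable_toReal_of_lintegral_ne_top F.lsc.measurable.aemeasurable hlt.ne
  have hb : ∫ _, F.b ∂μ = F.b := by simp [Measure.real, hone]
  have hgb : Integrable (fun x => (F.g x).toReal - F.b) μ := hgi.sub (integrable_const _)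
  have hgbp : Integrable (fun x => (F.g x).toReal - F.b + (potential κ F.θp x).toReal) μ :=
    hgb.add hp
  have heq : fieldIntegral f μ = ∫ x, (F.g x).toReal - F.b + (potential κ F.θp x).toReal -
      (potential κ F.θm x).toReal ∂μ := by
    refine integral_congr_ae ?_
    filter_upwards [hg, F.ae_lt_top hker hE hμ] with x hx hx'
    rw [F.eq x, (field_value hx'.1 hx'.2).2.2 hx]
  rw [heq, integral_sub hgbp hm, integral_add hgb hp, integral_sub hgi (integrable_const _), hb,
    integral_potential hker hE hμ F.memp, integral_potential hker hE hμ F.memm,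
    integral_toReal F.lsc.measurable.aemeasurable hg]

end Field

section Parallelogram

variable {κ : X → X → ℝ≥0∞} {f : X → EReal} {A : Set X}

omit [BorelSpace X] in
lemma memBreve.finEnergy {μ : Measure X} (hμ : memBreve κ A μ) : FinEnergy κ μ :=
  ⟨⟨by simp [hμ.2.2]⟩, hμ.1⟩

omit [BorelSpace X] in
lemma Admissible.finEnergy {μ : Measure X} (hμ : Admissible κ A f μ) : FinEnergy κ μ :=
  hμ.1.finEnergy

omit [BorelSpace X] in
lemma Admissible.mono {B : Set X} {μ : Measure X} (hμ : Admissible κ A f μ) (h : A ⊆ B) :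
    Admissible κ B f μ :=
  ⟨⟨hμ.1.1, fun K hK => measure_mono_null
    (inter_subset_inter_left _ (compl_subset_compl.2 h)) (hμ.1.2.1 K hK), hμ.1.2.2⟩, hμ.2⟩

omit [BorelSpace X] [TopologicalSpace X] in
lemma FieldIntegrable.add {μ ν : Measure X} (hμ : FieldIntegrable f μ)
    (hν : FieldIntegrable f ν) : FieldIntegrable f (μ + ν) :=
  ⟨hμ.1.add_measure hν.1, ae_add_measure_iff.2 ⟨hμ.2, hν.2⟩⟩

omit [BorelSpace X] [TopologicalSpace X] in
lemma FieldIntegrable.smul {μ : Measure X} (hμ : FieldIntegrable f μ) (c : NNReal) :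
    FieldIntegrable f (c • μ) :=
  ⟨hμ.1.smul_measure_nnreal, Measure.ae_smul_measure hμ.2 c⟩

variable [T2Space X]

lemma Admissible.midpoint (hker : IsKernel κ) (hE : EnergyPrinciple κ) {μ ν : Measure X}
    (hμ : Admissible κ A f μ) (hν : Admissible κ A f ν) :
    Admissible κ A f ((2⁻¹ : NNReal) • (μ + ν)) := by
  refine ⟨⟨((hμ.finEnergy.add hker hE hν.finEnergy).smul hker _).memEplus, fun K hK => ?_, ?_⟩,
    (hμ.2.add hν.2).smul _⟩
  · simp [hμ.1.2.1 K hK, hν.1.2.1 K hK]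
  · rw [Measure.smul_apply, Measure.add_apply, hμ.1.2.2, hν.1.2.2, ENNReal.smul_def, smul_eq_mul,
      one_add_one_eq_two, ENNReal.coe_inv two_ne_zero]
    exact ENNReal.inv_mul_cancel two_ne_zero (by simp)

lemma sqDist_eq_gaussI (hker : IsKernel κ) (hE : EnergyPrinciple κ) {μ ν : Measure X}
    (hμ : Admissible κ A f μ) (hν : Admissible κ A f ν) :
    sqDist κ μ ν = 2 * gaussI κ f μ + 2 * gaussI κ f ν -
      4 * gaussI κ f ((2⁻¹ : NNReal) • (μ + ν)) := by
  have := (hμ.finEnergy.add hker hE hν.finEnergy).finite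
  have h1 : fieldIntegral f ((2⁻¹ : NNReal) • (μ + ν)) =
      2⁻¹ * (fieldIntegral f μ + fieldIntegral f ν) := by
    unfold fieldIntegral
    rw [integral_smul_nnreal_measure, integral_add_measure hμ.2.1 hν.2.1]
    rfl
  have h2 := realEnergy_smul_self hker 2⁻¹ (μ + ν)
  rw [realEnergy_add_self hker hE hμ.finEnergy hν.finEnergy] at h2
  unfold gaussI
  rw [h1]
  change _ = 2 * (realEnergy κ μ μ + _) + 2 * (realEnergy κ ν ν + _) - 4 * (realEnergy κ _ _ + _)
  rw [h2]
  unfold sqDist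
  push_cast
  ring

lemma sqDist_le_gaussI (hker : IsKernel κ) (hE : EnergyPrinciple κ) {μ ν : Measure X} {w : ℝ}
    (hw : (w : EReal) ≤ wf κ A f) (hμ : Admissible κ A f μ) (hν : Admissible κ A f ν) :
    sqDist κ μ ν ≤ 2 * gaussI κ f μ + 2 * gaussI κ f ν - 4 * w := by
  rw [sqDist_eq_gaussI hker hE hμ hν]
  have : (w : EReal) ≤ gaussI κ f ((2⁻¹ : NNReal) • (μ + ν)) :=
    hw.trans (iInf₂_le _ (hμ.midpoint hker hE hν))
  have := EReal.coe_le_coe_iff.1 this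
  linarith

lemma IsSolution.unique (hker : IsKernel κ) (hE : EnergyPrinciple κ) {μ ν : Measure X}
    (hμ : IsSolution κ A f μ) (hν : IsSolution κ A f ν) : μ = ν := by
  refine eq_of_sqDist_le_zero hE hμ.1.1.1 hν.1.1.1 ?_
  have h := sqDist_le_gaussI hker hE hμ.2.le hμ.1 hν.1
  have : gaussI κ f μ = gaussI κ f ν := EReal.coe_eq_coe_iff.1 (hμ.2.trans hν.2.symm)
  linarith

end Parallelogram

section Vague

variable {A K : Set X}

lemma Concentrated.measure_compl_eq_zero [T2Space X] {μ : Measure X} [IsFiniteMeasure μ] [μ.Regular]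
    (h : Concentrated μ A) : μ Aᶜ = 0 := by
  refine le_antisymm (ENNReal.le_of_forall_pos_le_add fun ε hε _ => ?_) zero_le
  obtain ⟨C, -, hC, hlt⟩ := MeasurableSet.univ.exists_isCompact_lt_add (measure_ne_top μ univ)
    (ENNReal.coe_pos.2 hε).ne'
  have hCc : μ Cᶜ ≤ ε := by
    rw [measure_compl hC.measurableSet (measure_ne_top μ C), tsub_le_iff_left]
    exact hlt.le
  calc μ Aᶜ ≤ μ (Aᶜ ∩ C) + μ Cᶜ := (measure_mono fun x hx => by
        by_cases hxC : x ∈ C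
        · exact Or.inl ⟨hx, hxC⟩
        · exact Or.inr hxC).trans (measure_union_le _ _)
    _ ≤ 0 + ε := by rw [h C hC]; gcongr

variable [T2Space X] [LocallyCompactSpace X]

/-- Compactly supported continuous nonnegative minorants of `g`. -/
def Minorant {X : Type*} [TopologicalSpace X] (g : X → ℝ≥0∞) : Type _ :=
  {φ : X → ℝ // Continuous φ ∧ HasCompactSupport φ ∧ (∀ x, 0 ≤ φ x) ∧
    ∀ x, ENNReal.ofReal (φ x) ≤ g x}

omit [MeasurableSpace X] [BorelSpace X] in
lemma iSup_minorant {g : X → ℝ≥0∞} (hg : LowerSemicontinuous g) (x : X) :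
    ⨆ φ : Minorant g, ENNReal.ofReal (φ.1 x) = g x := by
  refine le_antisymm (iSup_le fun φ => φ.2.2.2.2 x) (le_of_forall_lt fun c hc => ?_)
  obtain ⟨d, hcd, hd⟩ := ENNReal.lt_iff_exists_nnreal_btwn.1 hc
  have hU : IsOpen {y | (d : ℝ≥0∞) < g y} := hg.isOpen_preimage d
  obtain ⟨φ, h1, h0, hφ, hI⟩ := exists_continuous_one_zero_of_isCompact (isCompact_singleton (x := x))
    hU.isClosed_compl (by simpa using hd)
  refine lt_of_lt_of_le ?_ (le_iSup (fun φ : Minorant g => ENNReal.ofReal (φ.1 x))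
    ⟨fun y => d * φ y, by fun_prop, hφ.mul_left, fun y => mul_nonneg d.2 (hI y).1, fun y => ?_⟩)
  · simpa [h1 (mem_singleton x)] using hcd
  · by_cases hy : (d : ℝ≥0∞) < g y
    · refine le_trans ?_ hy.le
      rw [ENNReal.ofReal_le_iff_le_toReal ENNReal.coe_ne_top]
      exact mul_le_of_le_one_right d.2 (hI y).2
    · simp [h0 (show y ∈ {y | (d : ℝ≥0∞) < g y}ᶜ from hy)]

lemma lintegral_le_of_vagueTendsto {μ : ℕ → Measure X} {μ₀ : Measure X} [∀ n, (μ n).Regular]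
    [μ₀.Regular] (h : VagueTendstoSeq μ μ₀) {g : X → ℝ≥0∞} (hg : LowerSemicontinuous g)
    {c : ℝ≥0∞} (hc : ∀ᶠ n in atTop, ∫⁻ x, g x ∂(μ n) ≤ c) : ∫⁻ x, g x ∂μ₀ ≤ c := by
  simp_rw [← iSup_minorant hg]
  rw [lintegral_iSup_of_lowerSemicontinuous]
  · refine iSup_le fun φ => ?_
    have hint : ∀ (ν : Measure X) [ν.Regular],
        ENNReal.ofReal (∫ x, φ.1 x ∂ν) = ∫⁻ x, ENNReal.ofReal (φ.1 x) ∂ν := fun ν _ =>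
      ofReal_integral_eq_lintegral_ofReal (φ.2.1.integrable_of_hasCompactSupport φ.2.2.1)
        (Eventually.of_forall φ.2.2.2.1)
    rw [← hint]
    refine le_of_tendsto (ENNReal.tendsto_ofReal (h φ.1 φ.2.1 φ.2.2.1)) (hc.mono fun n hn => ?_)
    rw [hint]
    exact (lintegral_mono φ.2.2.2.2).trans hn
  · exact fun φ => (ENNReal.continuous_ofReal.comp φ.2.1).lowerSemicontinuous
  · intro φ ψ
    refine ⟨⟨fun x => max (φ.1 x) (ψ.1 x), φ.2.1.max ψ.2.1, ?_, fun x => le_max_of_le_left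
      (φ.2.2.2.1 x), fun x => ?_⟩, fun x => ENNReal.ofReal_le_ofReal (le_max_left _ _),
      fun x => ENNReal.ofReal_le_ofReal (le_max_right _ _)⟩
    · refine HasCompactSupport.intro (φ.2.2.1.isCompact.union ψ.2.2.1.isCompact) fun x hx => ?_
      rw [mem_union, not_or] at hx
      rw [image_eq_zero_of_notMem_tsupport hx.1, image_eq_zero_of_notMem_tsupport hx.2, max_self]
    · rw [ENNReal.ofReal_max]
      exact max_le (φ.2.2.2.2 x) (ψ.2.2.2.2 x)

lemma measure_compl_eq_zero_of_vagueTendsto {μ : ℕ → Measure X} {μ₀ : Measure X}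
    [∀ n, (μ n).Regular] [μ₀.Regular] (h : VagueTendstoSeq μ μ₀) (hK : IsClosed K)
    (hμ : ∀ n, μ n Kᶜ = 0) : μ₀ Kᶜ = 0 := by
  have hg : LowerSemicontinuous (Kᶜ.indicator (1 : X → ℝ≥0∞)) :=
    hK.isOpen_compl.lowerSemicontinuous_indicator zero_le_one
  have := lintegral_le_of_vagueTendsto h hg (c := 0) (Eventually.of_forall fun n => by
    rw [lintegral_indicator_one hK.measurableSet.compl, hμ n])
  rwa [lintegral_indicator_one hK.measurableSet.compl, nonpos_iff_eq_zero] at this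

lemma measure_univ_eq_one_of_vagueTendsto {μ : ℕ → Measure X} {μ₀ : Measure X}
    [∀ n, (μ n).Regular] [μ₀.Regular] (h : VagueTendstoSeq μ μ₀) (hK : IsCompact K)
    (hμ : ∀ n, μ n Kᶜ = 0) (hone : ∀ n, μ n univ = 1) : μ₀ univ = 1 := by
  obtain ⟨φ, h1, -, hφ, -⟩ := exists_continuous_one_zero_of_isCompact hK isClosed_empty
    (disjoint_empty K)
  have hint : ∀ ν : Measure X, ν Kᶜ = 0 → ∫ x, φ x ∂ν = ν.real univ := fun ν hν => by
    have hae : φ =ᵐ[ν] fun _ => (1 : ℝ) := by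
      filter_upwards [compl_mem_ae_iff.2 hν] with x hx
      exact h1 (not_not.1 hx)
    rw [integral_congr_ae hae]
    simp
  have hlim := h φ φ.continuous hφ
  rw [hint μ₀ (measure_compl_eq_zero_of_vagueTendsto h hK.isClosed hμ)] at hlim
  have hreal : μ₀.real univ = 1 := tendsto_nhds_unique hlim (by
    simp [hint _ (hμ _), Measure.real, hone])
  rwa [Measure.real, ENNReal.toReal_eq_one_iff] at hreal

end Vague

section Existence

variable {κ : X → X → ℝ≥0∞} {f : X → EReal} {A K : Set X}

omit [BorelSpace X] in
lemma tendsto_sqDist_of_strongTendsto (hE : EnergyPrinciple κ) {μ : ℕ → Measure X}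
    {μ₀ : Measure X} (hμ : ∀ n, memEplus κ (μ n)) (hμ₀ : memEplus κ μ₀)
    (h : StrongTendstoSeq κ μ μ₀) : Tendsto (fun n => sqDist κ (μ n) μ₀) atTop (𝓝 0) := by
  have h2 := h.pow 2
  rw [zero_pow two_ne_zero] at h2
  refine h2.congr fun n => ?_
  rw [strongDist_eq, Real.sq_sqrt (sqDist_nonneg hE (hμ n) hμ₀)]

omit [BorelSpace X] in
lemma exists_gaussI_lt {w c : ℝ} (hw : wf κ A f ≤ w) (hc : w < c) :
    ∃ μ, Admissible κ A f μ ∧ gaussI κ f μ < c := by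
  have : wf κ A f < c := hw.trans_lt (EReal.coe_lt_coe_iff.2 hc)
  simp only [wf, iInf_lt_iff] at this
  obtain ⟨μ, hμ, hlt⟩ := this
  exact ⟨μ, hμ, EReal.coe_lt_coe_iff.1 hlt⟩

variable [T2Space X]

lemma strongCauchySeq_of_gaussI (hker : IsKernel κ) (hE : EnergyPrinciple κ) {w : ℝ}
    (hw : (w : EReal) ≤ wf κ A f) {μ : ℕ → Measure X} (hμ : ∀ n, Admissible κ A f (μ n))
    (hlim : Tendsto (fun n => gaussI κ f (μ n)) atTop (𝓝 w)) : StrongCauchySeq κ μ := by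
  intro ε hε
  have hlt : w < w + ε ^ 2 / 4 := by linarith [pow_pos hε 2]
  obtain ⟨N, hN⟩ := eventually_atTop.1 (hlim.eventually_lt_const hlt)
  refine ⟨N, fun m hm n hn => ?_⟩
  rw [strongDist_eq, Real.sqrt_lt' hε]
  linarith [sqDist_le_gaussI hker hE hw (hμ m) (hμ n), hN m hm, hN n hn]

variable [LocallyCompactSpace X]

lemma FieldData.gaussI_eq (F : FieldData κ f) (hker : IsKernel κ) (hE : EnergyPrinciple κ)
    {μ : Measure X} (hμ : Admissible κ A f μ) :
    gaussI κ f μ = realEnergy κ μ μ + 2 * ((∫⁻ x, F.g x ∂μ).toReal - F.b +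
      (∫⁻ x, potential κ F.θp x ∂μ).toReal - (∫⁻ x, potential κ F.θm x ∂μ).toReal) := by
  rw [gaussI, F.fieldIntegral_eq hker hE hμ.finEnergy hμ.1.2.2 hμ.2]
  rfl

/-- A minimizer over a compact set exists as soon as the infimum is finite. -/
theorem FieldData.exists_isSolution (F : FieldData κ f) (hker : IsKernel κ)
    (hperf : IsPerfect κ) (hK : IsCompact K) {w : ℝ} (hw : wf κ K f = w) :
    ∃ l, IsSolution κ K f l := by
  obtain ⟨hE, hcomplete, hvague⟩ := hperf
  have hmin : ∀ n : ℕ, ∃ μ, Admissible κ K f μ ∧ gaussI κ f μ < w + 1 / ((n : ℝ) + 1) :=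
    fun n => exists_gaussI_lt hw.le (lt_add_of_pos_right w (by positivity))
  choose μ hμ hlt using hmin
  have hge : ∀ ν, Admissible κ K f ν → w ≤ gaussI κ f ν := fun ν hν =>
    EReal.coe_le_coe_iff.1 (hw ▸ iInf₂_le ν hν)
  have hlim : Tendsto (fun n => gaussI κ f (μ n)) atTop (𝓝 w) := by
    refine tendsto_of_tendsto_of_tendsto_of_le_of_le tendsto_const_nhds ?_
      (fun n => hge _ (hμ n)) fun n => (hlt n).le
    simpa using tendsto_one_div_add_atTop_nhds_zero_nat.const_add w
  have hmem : ∀ n, memEplus κ (μ n) := fun n => (hμ n).1.1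
  obtain ⟨μ₀, hμ₀, hstrong⟩ := hcomplete μ hmem (strongCauchySeq_of_gaussI hker hE hw.ge hμ hlim)
  have hv := hvague μ μ₀ hmem hμ₀ hstrong
  have hsq := tendsto_sqDist_of_strongTendsto hE hmem hμ₀ hstrong
  have hreg : ∀ n, (μ n).Regular := fun n => (hmem n).1
  have : μ₀.Regular := hμ₀.1
  have hnull : ∀ n, μ n Kᶜ = 0 := fun n => by
    have := (hμ n).finEnergy.finite
    exact (hμ n).1.2.1.measure_compl_eq_zero
  have hone : μ₀ univ = 1 :=
    measure_univ_eq_one_of_vagueTendsto hv hK hnull fun n => (hμ n).1.2.2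
  have hbreve : memBreve κ K μ₀ := ⟨hμ₀, fun C _ => measure_mono_null inter_subset_left
    (measure_compl_eq_zero_of_vagueTendsto hv hK.isClosed hnull), hone⟩
  have hfin : ∀ n, FinEnergy κ (μ n) := fun n => (hμ n).finEnergy
  have hEn := tendsto_realEnergy_self hker hE hfin hbreve.finEnergy hsq
  have hp := tendsto_lintegral_potential hker hE hfin hbreve.finEnergy F.memp hsq
  have hm := tendsto_lintegral_potential hker hE hfin hbreve.finEnergy F.memm hsq
  have hg := ((((hlim.sub hEn).div_const 2).add_const F.b).sub hp).add hm
  set L := (w - realEnergy κ μ₀ μ₀) / 2 + F.b - (∫⁻ x, potential κ F.θp x ∂μ₀).toReal +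
    (∫⁻ x, potential κ F.θm x ∂μ₀).toReal with hL
  replace hg : Tendsto (fun n => (∫⁻ x, F.g x ∂(μ n)).toReal) atTop (𝓝 L) := by
    refine hg.congr fun n => ?_
    rw [F.gaussI_eq hker hE (hμ n)]
    ring
  have hL0 : 0 ≤ L := ge_of_tendsto' hg fun n => ENNReal.toReal_nonneg
  have hle : ∀ ε : ℝ, 0 < ε → ∫⁻ x, F.g x ∂μ₀ ≤ ENNReal.ofReal (L + ε) := fun ε hε => by
    refine lintegral_le_of_vagueTendsto hv F.lsc ?_
    filter_upwards [hg.eventually_le_const (lt_add_of_pos_right L hε)] with n hn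
    exact (ENNReal.le_ofReal_iff_toReal_le
      ((F.fieldIntegrable_iff hker hE (hfin n)).1 (hμ n).2).ne (by positivity)).2 hn
  have hadm : Admissible κ K f μ₀ := ⟨hbreve, (F.fieldIntegrable_iff hker hE hbreve.finEnergy).2
    ((hle 1 one_pos).trans_lt ENNReal.ofReal_lt_top)⟩
  have hgL : (∫⁻ x, F.g x ∂μ₀).toReal ≤ L := le_of_forall_pos_le_add fun ε hε =>
    ENNReal.toReal_le_of_le_ofReal (by positivity) (hle ε hε)
  refine ⟨μ₀, hadm, ?_⟩
  rw [hw, EReal.coe_eq_coe_iff]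
  refine le_antisymm ?_ (hge μ₀ hadm)
  rw [F.gaussI_eq hker hE hadm]
  linarith

end Existence

section Approximation

variable {κ : X → X → ℝ≥0∞} {f : X → EReal} {A : Set X}

lemma Concentrated.exists_isCompact_seq [T2Space X] {μ : Measure X} [IsFiniteMeasure μ]
    [μ.Regular] (h : Concentrated μ A) (hone : μ univ = 1) :
    ∃ C : ℕ → Set X, (∀ n, IsCompact (C n) ∧ C n ⊆ A) ∧
      Tendsto (fun n => μ (C n)ᶜ) atTop (𝓝 0) := by
  set B := (toMeasurable μ Aᶜ)ᶜ with hB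
  have hBA : B ⊆ A := compl_subset_comm.1 (subset_toMeasurable μ Aᶜ)
  have hBm : MeasurableSet B := (measurableSet_toMeasurable μ Aᶜ).compl
  have hB1 : μ B = 1 := by
    rw [hB, measure_compl (measurableSet_toMeasurable μ Aᶜ) (measure_ne_top _ _),
      measure_toMeasurable, h.measure_compl_eq_zero, hone, tsub_zero]
  have hex : ∀ n : ℕ, ∃ C ⊆ B, IsCompact C ∧ μ B < μ C + (n : ℝ≥0∞)⁻¹ := fun n =>
    hBm.exists_isCompact_lt_add (measure_ne_top μ B) (by simp)
  choose C hCB hC hlt using hex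
  refine ⟨C, fun n => ⟨hC n, (hCB n).trans hBA⟩, ?_⟩
  refine tendsto_of_tendsto_of_tendsto_of_le_of_le tendsto_const_nhds
    ENNReal.tendsto_inv_nat_nhds_zero (fun n => zero_le) fun n => ?_
  rw [measure_compl (hC n).measurableSet (measure_ne_top _ _), hone, ← hB1]
  exact tsub_le_iff_left.2 (hlt n).le

lemma Admissible.normalized_restrict [T2Space X] (hker : IsKernel κ) (hE : EnergyPrinciple κ)
    {μ : Measure X} (hμ : Admissible κ A f μ) {C : Set X} (hC : IsCompact C) {a : NNReal}
    (ha : μ C = a) (ha0 : a ≠ 0) :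
    Admissible κ C f (a⁻¹ • μ.restrict C) ∧ gaussI κ f (a⁻¹ • μ.restrict C) ≤
      (a : ℝ)⁻¹ ^ 2 * realEnergy κ μ μ + 2 * ((a : ℝ)⁻¹ * ∫ x in C, (f x).toReal ∂μ) := by
  have := hμ.finEnergy.finite
  have hres := FinEnergy.restrict hE hμ.1.1 (measure_lt_top μ C)
  refine ⟨⟨⟨(hres.smul hker _).memEplus, fun D _ => ?_, ?_⟩,
    FieldIntegrable.smul ⟨hμ.2.1.restrict, ae_restrict_of_ae hμ.2.2⟩ _⟩, ?_⟩
  · refine measure_mono_null inter_subset_left ?_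
    rw [Measure.smul_apply, Measure.restrict_apply hC.measurableSet.compl, compl_inter_self,
      measure_empty, smul_zero]
  · rw [Measure.smul_apply, Measure.restrict_apply_univ, ha, ENNReal.smul_def, smul_eq_mul,
      ← ENNReal.coe_mul, inv_mul_cancel₀ ha0, ENNReal.coe_one]
  · have h1 : fieldIntegral f (a⁻¹ • μ.restrict C) =
        (a : ℝ)⁻¹ * ∫ x in C, (f x).toReal ∂μ := by
      rw [fieldIntegral, integral_smul_nnreal_measure]
      rfl
    have h2 := realEnergy_smul_self hker a⁻¹ (μ.restrict C)
    have h3 : realEnergy κ (μ.restrict C) (μ.restrict C) ≤ realEnergy κ μ μ :=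
      ENNReal.toReal_mono hμ.1.1.2.ne (energy_restrict_le hE hμ.1.1 (measure_lt_top μ C))
    rw [gaussI, h1]
    change realEnergy κ _ _ + _ ≤ _
    rw [h2, NNReal.coe_inv]
    gcongr

/-- Admissible measures on `A` are approximated in energy by admissible measures on compact
subsets of `A`. -/
lemma Admissible.exists_isCompact [T2Space X] (hker : IsKernel κ) (hE : EnergyPrinciple κ)
    {l : Measure X} (hl : Admissible κ A f l) {ε : ℝ} (hε : 0 < ε) :
    ∃ K, IsCompact K ∧ K ⊆ A ∧ ∃ μ, Admissible κ K f μ ∧ gaussI κ f μ < gaussI κ f l + ε := by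
  have := hl.finEnergy.finite
  have : l.Regular := hl.1.1.1
  have hone := hl.1.2.2
  obtain ⟨C, hC, hlim⟩ := hl.1.2.1.exists_isCompact_seq hone
  have ha : Tendsto (fun n => ((l (C n)).toNNReal : ℝ)) atTop (𝓝 1) := by
    have h := (ENNReal.tendsto_toReal ENNReal.zero_ne_top).comp hlim
    have h1 := h.const_sub (1 : ℝ)
    rw [ENNReal.toReal_zero, sub_zero] at h1
    refine h1.congr fun n => ?_
    have := measureReal_compl (μ := l) (hC n).1.measurableSet
    simp only [Measure.real, hone, ENNReal.toReal_one] at this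
    simp only [Function.comp_apply, this]
    exact sub_sub_cancel 1 _
  have hint : Tendsto (fun n => ∫ x in C n, (f x).toReal ∂l) atTop (𝓝 (fieldIntegral f l)) := by
    have h := (hl.2.1.tendsto_setIntegral_nhds_zero hlim).const_sub (fieldIntegral f l)
    rw [sub_zero] at h
    refine h.congr fun n => ?_
    rw [fieldIntegral, ← integral_add_compl (hC n).1.measurableSet hl.2.1, add_sub_cancel_right]
  have hinv := ha.inv₀ one_ne_zero
  have hbound := ((hinv.pow 2).mul_const (realEnergy κ l l)).add ((hinv.mul hint).const_mul 2)
  rw [inv_one, one_pow, one_mul, one_mul] at hbound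
  have hlt : realEnergy κ l l + 2 * fieldIntegral f l < gaussI κ f l + ε :=
    lt_add_of_pos_right (gaussI κ f l) hε
  obtain ⟨n, hn, hn0⟩ := ((hbound.eventually_lt_const hlt).and (ha.eventually_ne one_ne_zero)).exists
  obtain ⟨hadm, hle⟩ := hl.normalized_restrict hker hE (hC n).1
    (ENNReal.coe_toNNReal (measure_ne_top l (C n))).symm (by exact_mod_cast hn0)
  exact ⟨C n, (hC n).1, (hC n).2, _, hadm, hle.trans_lt hn⟩

end Approximation

section Convergence

variable {κ : X → X → ℝ≥0∞} {f : X → EReal} {A K : Set X}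

omit [BorelSpace X] in
lemma IsPerfect.tendsto_integral {ι : Type*} {F : Filter ι} (hperf : IsPerfect κ)
    {μ : ι → Measure X} {l : Measure X} (hl : memEplus κ l) (hμ : ∀ᶠ i in F, memEplus κ (μ i))
    (h : Tendsto (fun i => strongDist κ (μ i) l) F (𝓝 0)) {φ : X → ℝ} (hφ : Continuous φ)
    (hφc : HasCompactSupport φ) : Tendsto (fun i => ∫ x, φ x ∂(μ i)) F (𝓝 (∫ x, φ x ∂l)) := by
  rw [Metric.tendsto_nhds]
  intro ε hε
  obtain ⟨δ, hδ, hδε⟩ : ∃ δ : ℝ, 0 < δ ∧ ∀ ν, memEplus κ ν → strongDist κ ν l < δ →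
      dist (∫ x, φ x ∂ν) (∫ x, φ x ∂l) < ε := by
    by_contra! hcon
    choose ν hν hlt hge using fun n : ℕ => hcon (1 / ((n : ℝ) + 1)) (by positivity)
    have hs : StrongTendstoSeq κ ν l := squeeze_zero (fun n => Real.sqrt_nonneg _)
      (fun n => (hlt n).le) tendsto_one_div_add_atTop_nhds_zero_nat
    obtain ⟨n, hn⟩ :=
      (Metric.tendsto_nhds.1 (hperf.2.2 ν l hν hl hs φ hφ hφc) ε hε).exists
    exact (hge n).not_gt hn
  filter_upwards [hμ, h.eventually_lt_const hδ] with i hi hi' using hδε _ hi hi'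

omit [BorelSpace X] in
lemma wf_anti {B : Set X} (h : A ⊆ B) : wf κ B f ≤ wf κ A f :=
  le_iInf₂ fun μ hμ => iInf₂_le μ (hμ.mono h)

variable [T2Space X]

lemma IsSolution.strongDist_lt (hker : IsKernel κ) (hE : EnergyPrinciple κ) {l lK μ : Measure X}
    (hl : IsSolution κ A f l) (hK : IsSolution κ K f lK) (hKA : K ⊆ A) (hμ : Admissible κ K f μ)
    {ε : ℝ} (hε : 0 < ε) (hlt : gaussI κ f μ < gaussI κ f l + ε ^ 2 / 2) :
    strongDist κ lK l < ε := by
  rw [strongDist_eq, Real.sqrt_lt' hε]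
  have h1 := sqDist_le_gaussI hker hE hl.2.le (hK.1.mono hKA) hl.1
  have h2 : gaussI κ f lK ≤ gaussI κ f μ :=
    EReal.coe_le_coe_iff.1 (hK.2.le.trans (iInf₂_le μ hμ))
  linarith

lemma IsSolution.existsUnique_of_subset [LocallyCompactSpace X] (hker : IsKernel κ)
    (hperf : IsPerfect κ) (hf : IsExternalField κ f) {l μ : Measure X} (hl : IsSolution κ A f l)
    (hK : IsCompact K) (hKA : K ⊆ A) (hμ : Admissible κ K f μ) : ∃! lK, IsSolution κ K f lK := by
  obtain ⟨F⟩ := hf.nonempty_fieldData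
  have htop : wf κ K f ≠ ⊤ := ((iInf₂_le μ hμ).trans_lt (EReal.coe_lt_top _)).ne
  have hbot : wf κ K f ≠ ⊥ := ((EReal.bot_lt_coe _).trans_le (hl.2.le.trans (wf_anti hKA))).ne'
  obtain ⟨lK, hlK⟩ := F.exists_isSolution hker hperf hK (EReal.coe_toReal htop hbot).symm
  exact ⟨lK, hlK, fun ν hν => hν.unique hker hperf.1 hlK⟩

end Convergence

end Topological

theorem stmt2 {X : Type*} [TopologicalSpace X] [T2Space X] [LocallyCompactSpace X]
    [MeasurableSpace X] [BorelSpace X]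
    (κ : X → X → ℝ≥0∞) (f : X → EReal) (A : Set X)
    (hker : IsKernel κ) (hperf : IsPerfect κ) (hf : IsExternalField κ f)
    (hw : wf κ A f < ⊤)
    (l : Measure X) (hl : IsSolution κ A f l) :
    ∃ K₀ : Set X, IsCompact K₀ ∧ K₀ ⊆ A ∧
      (∀ K : Set X, IsCompact K → K ⊆ A → K₀ ⊆ K →
        ∃! lK : Measure X, IsSolution κ K f lK) ∧
      ∀ lam : {K : Set X // IsCompact K ∧ K ⊆ A} → Measure X,
        (∀ K : {K : Set X // IsCompact K ∧ K ⊆ A}, K₀ ⊆ K.1 →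
          IsSolution κ K.1 f (lam K)) →
        -- convergence in the strong metric as `K ↑ A`
        Tendsto (fun K => strongDist κ (lam K) l) atTop (𝓝 0) ∧
        -- vague convergence as `K ↑ A`
        ∀ φ : X → ℝ, Continuous φ → HasCompactSupport φ →
          Tendsto (fun K => ∫ x, φ x ∂(lam K)) atTop (𝓝 (∫ x, φ x ∂l)) := by

  have hE := hperf.1
  obtain ⟨K₀, hK₀, hK₀A, μ₀, hμ₀, -⟩ := hl.1.exists_isCompact hker hE one_pos
  refine ⟨K₀, hK₀, hK₀A, fun K hK hKA hsub =>
    hl.existsUnique_of_subset hker hperf hf hK hKA (hμ₀.mono hsub), fun lam hlam => ?_⟩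
  have hstrong : Tendsto (fun K => strongDist κ (lam K) l) atTop (𝓝 0) := by
    rw [Metric.tendsto_nhds]
    intro ε hε
    obtain ⟨C, hC, hCA, μ, hμ, hlt⟩ := hl.1.exists_isCompact hker hE
      (ε := ε ^ 2 / 2) (by positivity)
    filter_upwards [eventually_ge_atTop
      (⟨K₀ ∪ C, hK₀.union hC, union_subset hK₀A hCA⟩ : {K : Set X // IsCompact K ∧ K ⊆ A})]
      with K hK
    have hsub : K₀ ∪ C ⊆ K.1 := hK
    rw [Real.dist_0_eq_abs, strongDist_eq, abs_of_nonneg (Real.sqrt_nonneg _)]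
    exact hl.strongDist_lt hker hE (hlam K (subset_union_left.trans hsub)) K.2.2
      (hμ.mono (subset_union_right.trans hsub)) hε hlt
  refine ⟨hstrong, fun φ hφ hφc => hperf.tendsto_integral hl.1.1.1 ?_ hstrong hφ hφc⟩
  filter_upwards [eventually_ge_atTop
    (⟨K₀, hK₀, hK₀A⟩ : {K : Set X // IsCompact K ∧ K ⊆ A})] with K hK
  exact (hlam K hK).1.1.1

end GaussVar
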